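/- Let p, q, p', q' be natural numbers. If Ψ_S^{2p}·Ψ_{T'}^{2q'} = Ψ_{S'}^{2p'}·Ψ_T^{2q} holds in the ring Q, then p = q = p' = q' = 0. (This handles the remaining mixed-sign case in the proof of the proposition that img(m) ≠ img(m').) -/

import Mathlib

/- Λ₄ is the group algebra of ℝ⁴ over ℝ; `E β` is the Novikov monomial e^β,
   δ i the standard basis vectors of ℝ⁴.  `Q` is the Künneth model of the
   quantum homology of M = (S²×S²)×(S²×S²) with form (ω₀⊕λω₀)⊕(−ω₀⊕−λω₀):
   the quotient of Λ₄[U₁,U₂,U₃,U₄] by U₁²−e^{−δ₁}, U₂²−e^{−δ₂}, U₃²−e^{δ₃},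
   U₄²−e^{δ₄}; `u i` are the images of the variables (u₁,u₂,w₃,w₄). -/

noncomputable section

abbrev Λ₄ : Type := AddMonoidAlgebra ℝ (Fin 4 → ℝ)

def E (β : Fin 4 → ℝ) : Λ₄ := AddMonoidAlgebra.single β 1

def δ (i : Fin 4) : Fin 4 → ℝ := Pi.single i 1

def qRel : Ideal (MvPolynomial (Fin 4) Λ₄) :=
  Ideal.span {MvPolynomial.X 0 ^ 2 - MvPolynomial.C (E (-δ 0)),
              MvPolynomial.X 1 ^ 2 - MvPolynomial.C (E (-δ 1)),
              MvPolynomial.X 2 ^ 2 - MvPolynomial.C (E (δ 2)),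
              MvPolynomial.X 3 ^ 2 - MvPolynomial.C (E (δ 3))}

abbrev Q : Type := MvPolynomial (Fin 4) Λ₄ ⧸ qRel

def u (i : Fin 4) : Q := Ideal.Quotient.mk qRel (MvPolynomial.X i)

def eQ (β : Fin 4 → ℝ) : Q := algebraMap Λ₄ Q (E β)

/-- Ψ_S = (u₁+u₂)·e^{(1/2+h)δ₁−hδ₂} -/
def ΨS (h : ℝ) : Q := (u 0 + u 1) * eQ ((1 / 2 + h) • δ 0 - h • δ 1)

/-- Ψ_T = −(w₃+w₄)·e^{−(1/2+h)δ₃+hδ₄} -/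
def ΨT (h : ℝ) : Q := -((u 2 + u 3) * eQ (-((1 / 2 + h) • δ 2) + h • δ 3))

/-- Ψ_{S'} = (u₁−w₄)·e^{(1/2+h)δ₁+hδ₄} -/
def ΨS' (h : ℝ) : Q := (u 0 - u 3) * eQ ((1 / 2 + h) • δ 0 + h • δ 3)

/-- Ψ_{T'} = (u₂−w₃)·e^{−(1/2+h)δ₃−hδ₂} -/
def ΨT' (h : ℝ) : Q := (u 1 - u 2) * eQ (-((1 / 2 + h) • δ 2) - h • δ 1)

/-- The augmentation `Λ₄ → ℝ`, sending every Novikov monomial to `1`. -/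
def augmentation : Λ₄ →+* ℝ :=
  (AddMonoidAlgebra.lift ℝ ℝ (Fin 4 → ℝ) (1 : Multiplicative (Fin 4 → ℝ) →* ℝ)).toRingHom

theorem augmentation_E (β : Fin 4 → ℝ) : augmentation (E β) = 1 := by
  simp [augmentation, E]

theorem eval₂Hom_eq_zero_of_mem_qRel {x : Fin 4 → ℝ} (hx : ∀ i, x i ^ 2 = 1)
    (a : MvPolynomial (Fin 4) Λ₄) (ha : a ∈ qRel) :
    MvPolynomial.eval₂Hom augmentation x a = 0 := by
  suffices h : qRel ≤ RingHom.ker (MvPolynomial.eval₂Hom augmentation x) from h ha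
  refine Ideal.span_le.2 ?_
  rintro _ (rfl | rfl | rfl | rfl) <;>
    simp [RingHom.mem_ker, augmentation_E, hx]

/-- The real point of `Q` over the augmentation at which `u i` takes the value `x i`. -/
def realPoint (x : Fin 4 → ℝ) (hx : ∀ i, x i ^ 2 = 1) : Q →+* ℝ :=
  Ideal.Quotient.lift qRel (MvPolynomial.eval₂Hom augmentation x)
    (eval₂Hom_eq_zero_of_mem_qRel hx)

theorem realPoint_u (x : Fin 4 → ℝ) (hx : ∀ i, x i ^ 2 = 1) (i : Fin 4) :
    realPoint x hx (u i) = x i := by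
  simp [realPoint, u]

theorem realPoint_eQ (x : Fin 4 → ℝ) (hx : ∀ i, x i ^ 2 = 1) (β : Fin 4 → ℝ) :
    realPoint x hx (eQ β) = 1 := by
  change MvPolynomial.eval₂Hom augmentation x (MvPolynomial.C (E β)) = 1
  simp [augmentation_E]

/-- The identity between products of Seidel elements, evaluated at a real point of `Q`. -/
theorem realPoint_seidel_products {h : ℝ} {p q p' q' : ℕ}
    (heq : ΨS h ^ (2 * p) * ΨT' h ^ (2 * q') = ΨS' h ^ (2 * p') * ΨT h ^ (2 * q))
    (x : Fin 4 → ℝ) (hx : ∀ i, x i ^ 2 = 1) :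
    (x 0 + x 1) ^ (2 * p) * (x 1 - x 2) ^ (2 * q') =
      (x 0 - x 3) ^ (2 * p') * (-(x 2 + x 3)) ^ (2 * q) := by
  simpa only [ΨS, ΨT, ΨS', ΨT', map_mul, map_pow, map_add, map_sub, map_neg, realPoint_u,
    realPoint_eQ, mul_one] using congrArg (realPoint x hx) heq

/-- If Ψ_S^{2p}·Ψ_{T'}^{2q'} = Ψ_{S'}^{2p'}·Ψ_T^{2q} in Q then p = q = p' = q' = 0. -/
theorem seidel_products_mixed_case_two
    (lam : ℝ) (hlam : 1 < lam) (h : ℝ) (hh : h = 1 / (6 * lam * (lam - 1)))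
    (p q p' q' : ℕ)
    (heq : ΨS h ^ (2 * p) * ΨT' h ^ (2 * q') = ΨS' h ^ (2 * p') * ΨT h ^ (2 * q)) :
    p = 0 ∧ q = 0 ∧ p' = 0 ∧ q' = 0 := by
  have key := realPoint_seidel_products heq
  refine ⟨?_, ?_, ?_, ?_⟩ <;> by_contra hne
  · have := key ![1, -1, -1, -1] (by simp [Fin.forall_fin_succ])
    simp only [Matrix.cons_val] at this
    norm_num [hne] at this
  · have := key ![-1, -1, 1, -1] (by simp [Fin.forall_fin_succ])
    simp only [Matrix.cons_val] at this
    norm_num [hne] at this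
  · have := key ![1, 1, -1, 1] (by simp [Fin.forall_fin_succ])
    simp only [Matrix.cons_val] at this
    norm_num [hne] at this
  · have := key ![-1, 1, 1, 1] (by simp [Fin.forall_fin_succ])
    simp only [Matrix.cons_val] at this
    norm_num [hne] at this

end
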